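/- arXiv:2304.04731 — 7 statements merged into one kernel-verified Lean document; each statement's English description precedes it below -/
import Mathlib

section
/- Consider the Case 1 instance of the linearized data-center problem with b > 0, and assume (D/n)·(p + a) ≤ b + q·v_L < min(D, p) + a; set s = (min(D, p) + a)/(b + q·v_L), so s > 1. Let ρ̂ ∈ {0,1}^n be any vector such that for some row l one has Σ_{i=1}^n B_{l,i} ρ̂_i + a ρ̂_l ≥ min(D, p) + a. Then every v ∈ ℝ^m with v_j ≥ v_L for all j that satisfies the temperature constraints −Σ_{j=1}^m A_{l',j} v_j + Σ_{i=1}^n B_{l',i} ρ̂_i + a ρ̂_{l'} ≤ b for all rows l' satisfies Σ_{j=1}^m v_j ≥ (s − 1)·b/q + s·v_L + (m − 1)·v_L; in particular (Σ_{j=1}^m v_j)/(m·v_L) ≥ (s − 1)·b/(m·q·v_L). -/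
/-- lower bound on the cooling cost of any simple-rounding-type
solution ρ̂ in the Case 1 instance. -/
theorem stmt_1
    (n m D p : ℕ) (hn : 0 < n) (hm : 0 < m)
    (hD1 : 1 ≤ D) (hDn : D ≤ n) (hp1 : 1 ≤ p) (hpn : p ≤ n)
    (A : Matrix (Fin n) (Fin m) ℝ) (B : Matrix (Fin n) (Fin n) ℝ)
    (a b q vL s : ℝ) (ha : 0 < a) (hb : 0 < b) (hq : 0 < q) (hvL : 0 < vL)
    (hA : ∀ l, ∃ j0, A l j0 = q ∧ ∀ j, j ≠ j0 → A l j = 0)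
    (hB01 : ∀ l i, B l i = 0 ∨ B l i = 1)
    (hBrow : ∀ l, ∑ i, B l i = (p : ℝ))
    (hcond1 : ((D : ℝ) / n) * ((p : ℝ) + a) ≤ b + q * vL)
    (hcond2 : b + q * vL < min (D : ℝ) (p : ℝ) + a)
    (hs : s = (min (D : ℝ) (p : ℝ) + a) / (b + q * vL))
    (ρhat : Fin n → ℝ) (hρ01 : ∀ i, ρhat i = 0 ∨ ρhat i = 1)
    (l : Fin n)
    (hl : ∑ i, B l i * ρhat i + a * ρhat l ≥ min (D : ℝ) (p : ℝ) + a) :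
    ∀ v : Fin m → ℝ, (∀ j, vL ≤ v j) →
      (∀ l', -∑ j, A l' j * v j + ∑ i, B l' i * ρhat i + a * ρhat l' ≤ b) →
      (∑ j, v j ≥ (s - 1) * b / q + s * vL + ((m : ℝ) - 1) * vL ∧
       (∑ j, v j) / ((m : ℝ) * vL) ≥ (s - 1) * b / ((m : ℝ) * q * vL)) := by
  intro v hv hT
  obtain ⟨j0, hj0, hj⟩ := hA l
  have hK : 0 < b + q * vL := by positivity
  have hsK : min (D : ℝ) (p : ℝ) + a = s * (b + q * vL) := by
    rw [hs, div_mul_cancel₀ _ hK.ne']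
  have hs1 : 1 < s := by rw [hs, lt_div_iff₀ hK]; linarith
  have hrow : ∑ j, A l j * v j = q * v j0 := by
    rw [Finset.sum_eq_single j0 (fun j _ hne => by rw [hj j hne, zero_mul]) (by simp), hj0]
  have hv0 : (s - 1) * b / q + s * vL ≤ v j0 := by
    have h := hT l
    rw [hrow] at h
    have h1 : (s - 1) * b / q ≤ v j0 - s * vL := by
      rw [div_le_iff₀ hq]
      nlinarith
    linarith
  have hrest : ((m : ℝ) - 1) * vL ≤ ∑ j ∈ Finset.univ.erase j0, v j := by
    have h := Finset.card_nsmul_le_sum (Finset.univ.erase j0) v vL (fun j _ => hv j)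
    rwa [Finset.card_erase_of_mem (Finset.mem_univ j0), Finset.card_univ, Fintype.card_fin,
      nsmul_eq_mul, Nat.cast_pred hm] at h
  have hsum := Finset.add_sum_erase Finset.univ v (Finset.mem_univ j0)
  have hm1 : (1 : ℝ) ≤ m := by exact_mod_cast hm
  have hmain : (s - 1) * b / q + s * vL + ((m : ℝ) - 1) * vL ≤ ∑ j, v j := by linarith
  refine ⟨hmain, ?_⟩
  have hnonneg : 0 ≤ s * vL + ((m : ℝ) - 1) * vL :=
    add_nonneg (mul_nonneg (by linarith) hvL.le) (mul_nonneg (by linarith) hvL.le)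
  have hmv : 0 < (m : ℝ) * vL := by positivity
  have heq : (s - 1) * b / ((m : ℝ) * q * vL) = (s - 1) * b / q / ((m : ℝ) * vL) := by
    rw [div_div]
    congr 1
    ring
  rw [ge_iff_le, heq]
  exact div_le_div_of_nonneg_right (by linarith) hmv.le
end

section
/- Consider the Case 1 instance of the linearized data-center problem with B = B̂ a Case-1 matrix and with b ≥ 1 + a. Let ρ̂ ∈ {0,1}^n be the indicator vector of {1,…,D} (ρ̂_i = 1 for i ≤ D, ρ̂_i = 0 otherwise), and let v*_j = v_L for all j. Then (v*, ρ̂) is feasible for the integral problem (p1): Σ_i ρ̂_i = D and for every row l, −Σ_{j=1}^m A_{l,j} v*_j + Σ_{i=1}^n B̂_{l,i} ρ̂_i + a ρ̂_l ≤ b. Consequently the optimal value of the integral problem (p1) for this instance equals m·v_L. -/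
/-- with B a Case-1 matrix and b ≥ 1 + a, the indicator of the
first D servers together with v* = v_L is feasible for the integral problem,
and the optimal value of the integral problem equals m·v_L. -/
theorem stmt_3
    (n m D p : ℕ) (hn : 0 < n) (hm : 0 < m)
    (hD1 : 1 ≤ D) (hDn : D ≤ n) (hp1 : 1 ≤ p) (hpn : p ≤ n - D)
    (A : Matrix (Fin n) (Fin m) ℝ) (B : Matrix (Fin n) (Fin n) ℝ)
    (a b q vL : ℝ) (ha : 0 < a) (hq : 0 < q) (hvL : 0 < vL) (hb : 1 + a ≤ b)
    (hA : ∀ l, ∃ j0, A l j0 = q ∧ ∀ j, j ≠ j0 → A l j = 0)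
    (hB01 : ∀ i j, B i j = 0 ∨ B i j = 1)
    (hBrow : ∀ i, ∑ j, B i j = (p : ℝ))
    (hBdiag : ∀ i : Fin n, (i : ℕ) < D → B i i = 1)
    (hBoff : ∀ i j : Fin n, B i j = 1 → (i = j ∧ (i : ℕ) < D) ∨ D ≤ (j : ℕ)) :
    (∑ i : Fin n, (if (i : ℕ) < D then (1 : ℝ) else 0) = (D : ℝ)) ∧
    (∀ l : Fin n,
      -∑ j, A l j * vL + ∑ i, B l i * (if (i : ℕ) < D then (1 : ℝ) else 0)
        + a * (if (l : ℕ) < D then (1 : ℝ) else 0) ≤ b) ∧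
    IsLeast {c : ℝ | ∃ (v : Fin m → ℝ) (ρ : Fin n → ℝ),
      (∀ i, ρ i = 0 ∨ ρ i = 1) ∧ (∑ i, ρ i ≥ (D : ℝ)) ∧
      (∀ l, -∑ j, A l j * v j + ∑ i, B l i * ρ i + a * ρ l ≤ b) ∧
      (∀ j, vL ≤ v j) ∧ c = ∑ j, v j} ((m : ℝ) * vL) := by
  have hsum : ∑ i : Fin n, (if (i : ℕ) < D then (1 : ℝ) else 0) = (D : ℝ) := by
    rw [Fin.sum_univ_eq_sum_range (fun i => if i < D then (1 : ℝ) else 0) n,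
      Finset.sum_boole]
    congr 1
    have h : (Finset.range n).filter (fun i => i < D) = Finset.range D := by
      ext i
      simp only [Finset.mem_filter, Finset.mem_range]
      omega
    rw [h, Finset.card_range]
  have hfeas : ∀ l : Fin n,
      -∑ j, A l j * vL + ∑ i, B l i * (if (i : ℕ) < D then (1 : ℝ) else 0)
        + a * (if (l : ℕ) < D then (1 : ℝ) else 0) ≤ b := by
    intro l
    have hcool : 0 ≤ ∑ j, A l j * vL := by
      refine Finset.sum_nonneg fun j _ => mul_nonneg ?_ hvL.le
      obtain ⟨j0, h0, h1⟩ := hA l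
      by_cases h : j = j0
      · rw [h, h0]
        exact hq.le
      · rw [h1 j h]
    have hheat : ∑ i, B l i * (if (i : ℕ) < D then (1 : ℝ) else 0) ≤
        if (l : ℕ) < D then (1 : ℝ) else 0 := by
      calc ∑ i, B l i * (if (i : ℕ) < D then (1 : ℝ) else 0)
          ≤ ∑ i, if l = i then (if (l : ℕ) < D then (1 : ℝ) else 0) else 0 := by
            refine Finset.sum_le_sum fun i _ => ?_
            rcases hB01 l i with h | h
            · rw [h, zero_mul]
              split_ifs <;> norm_num
            · rcases hBoff l i h with ⟨rfl, hl⟩ | hi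
              · simp [h, hl]
              · rw [if_neg (not_lt.mpr hi), mul_zero]
                split_ifs <;> norm_num
        _ = if (l : ℕ) < D then (1 : ℝ) else 0 := by simp
    split_ifs at hheat ⊢ <;> linarith
  refine ⟨hsum, hfeas, ⟨fun _ => vL, fun i => if (i : ℕ) < D then 1 else 0, ?_, hsum.ge,
    hfeas, fun _ => le_rfl, by simp⟩, ?_⟩
  · intro i
    by_cases h : (i : ℕ) < D <;> simp [h]
  · rintro c ⟨v, ρ, -, -, -, hv, rfl⟩
    simpa using Finset.sum_le_sum fun j (_ : j ∈ Finset.univ) => hv j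
end

section
/- Let n ≥ 1, let D be an integer with 1 ≤ D ≤ n, let B be an n×n real matrix with nonnegative entries, let a > 0 and b ∈ ℝ. Then the optimal value of the problem: minimize v over v ∈ ℝ and ρ ∈ {0,1}^n subject to v ≥ 0, Σ_{i=1}^n ρ_i ≥ D, and −v + Σ_{i=1}^n B_{l,i} ρ_i + a ρ_l ≤ b for every l = 1,…,n, equals max(0, m* − b), where m* = min over ρ ∈ {0,1}^n with Σ_{i=1}^n ρ_i = D of max_{1 ≤ l ≤ n} (Σ_{i=1}^n B_{l,i} ρ_i + a ρ_l). In other words, the single-cooling-variable problem (3) is equivalent to the min-max problem (4) with B' = B + a·I. -/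
/-- A 0/1 vector whose sum is at least `D` dominates a 0/1 vector whose sum is exactly `D`. -/
theorem exists_zero_one_le_sum_eq {ι : Type*} [Fintype ι] {D : ℕ} {ρ : ι → ℝ}
    (hρ : ∀ i, ρ i = 0 ∨ ρ i = 1) (hD : (D : ℝ) ≤ ∑ i, ρ i) :
    ∃ σ : ι → ℝ, (∀ i, σ i = 0 ∨ σ i = 1) ∧ ∑ i, σ i = (D : ℝ) ∧ ∀ i, σ i ≤ ρ i := by
  classical
  have hsum : ∑ i, ρ i = ((Finset.univ.filter fun i => ρ i = 1).card : ℝ) := by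
    rw [Finset.card_filter, Nat.cast_sum]
    refine Finset.sum_congr rfl fun i _ => ?_
    rcases hρ i with h | h <;> simp [h]
  rw [hsum] at hD
  obtain ⟨s, hs, hcard⟩ := Finset.exists_subset_card_eq (Nat.cast_le.mp hD)
  refine ⟨fun i => if i ∈ s then 1 else 0, fun i => ?_, by simp [hcard], fun i => ?_⟩
  · by_cases h : i ∈ s <;> simp [h]
  · by_cases h : i ∈ s
    · simp [h, (Finset.mem_filter.mp (hs h)).2]
    · rcases hρ i with h' | h' <;> simp [h, h']

/-- the single-cooling-variable problem (3) has optimal value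
max(0, m* − b), where m* is the optimal value of the min-max problem (4)
with B' = B + a·I. -/
theorem stmt_4
    (n D : ℕ) (hn : 0 < n) (hD1 : 1 ≤ D) (hDn : D ≤ n)
    (B : Matrix (Fin n) (Fin n) ℝ) (hB : ∀ l i, 0 ≤ B l i)
    (a b : ℝ) (ha : 0 < a)
    (mstar : ℝ)
    (hmstar : IsLeast {t : ℝ | ∃ ρ : Fin n → ℝ,
        (∀ i, ρ i = 0 ∨ ρ i = 1) ∧ (∑ i, ρ i = (D : ℝ)) ∧
        t = Finset.univ.sup' ⟨⟨0, hn⟩, Finset.mem_univ _⟩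
              (fun l => ∑ i, B l i * ρ i + a * ρ l)} mstar) :
    IsLeast {c : ℝ | ∃ (v : ℝ) (ρ : Fin n → ℝ),
        0 ≤ v ∧ (∀ i, ρ i = 0 ∨ ρ i = 1) ∧ (∑ i, ρ i ≥ (D : ℝ)) ∧
        (∀ l, -v + ∑ i, B l i * ρ i + a * ρ l ≤ b) ∧ c = v}
      (max 0 (mstar - b)) := by
  obtain ⟨⟨ρ, hρ, hsum, hm⟩, hmin⟩ := hmstar
  constructor
  · refine ⟨_, ρ, le_max_left _ _, hρ, hsum.ge, fun l => ?_, rfl⟩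
    have hl := Finset.le_sup' (fun l => ∑ i, B l i * ρ i + a * ρ l) (Finset.mem_univ l)
    rw [← hm] at hl
    linarith [le_max_right 0 (mstar - b)]
  · rintro c ⟨v, τ, hv, hτ, hτD, hcon, rfl⟩
    obtain ⟨σ, hσ, hσD, hle⟩ := exists_zero_one_le_sum_eq hτ hτD
    refine max_le hv (sub_le_iff_le_add.mpr ((hmin ⟨σ, hσ, hσD, rfl⟩).trans ?_))
    refine Finset.sup'_le _ _ fun l _ => ?_
    have hB' : ∑ i, B l i * σ i ≤ ∑ i, B l i * τ i :=
      Finset.sum_le_sum fun i _ => mul_le_mul_of_nonneg_left (hle i) (hB l i)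
    linarith [hcon l, mul_le_mul_of_nonneg_left (hle l) ha.le]
end

section
/- Consider the linearized data-center problem (p1) in which all n rows of the cooling matrix A are equal to a fixed nonnegative vector α ∈ ℝ^m with α* = max_{1 ≤ j ≤ m} α_j > 0, with E = 0, V_LB = 0, and no upper bounds on v. Fix any ρ ∈ [0,1]^n and let t = max_{1 ≤ l ≤ n} (Σ_{i=1}^n B_{l,i} ρ_i + a ρ_l) − b. Then the minimum of Σ_{j=1}^m v_j over all v ∈ ℝ^m with v ≥ 0 satisfying the temperature constraints −Σ_{j=1}^m α_j v_j + Σ_{i=1}^n B_{l,i} ρ_i + a ρ_l ≤ b for all l equals max(0, t)/α*. In particular, the minimal cooling cost for a fixed workload ρ is proportional to the positive part of max_l ((Bρ)_l + a ρ_l) − b. -/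
/-- when all rows of the cooling matrix equal a fixed nonnegative
vector α with maximum α* > 0, E = 0, V_LB = 0 and no upper bounds, the minimal
cooling cost for a fixed workload ρ equals max(0, t)/α*, where
t = max_l ((Bρ)_l + aρ_l) − b. -/
theorem stmt_7
    (n m : ℕ) (hn : 0 < n) (hm : 0 < m)
    (α : Fin m → ℝ) (hα : ∀ j, 0 ≤ α j)
    (αstar : ℝ)
    (hαs : αstar = Finset.univ.sup' ⟨⟨0, hm⟩, Finset.mem_univ _⟩ α)
    (hαpos : 0 < αstar)
    (B : Matrix (Fin n) (Fin n) ℝ) (hB : ∀ l i, 0 ≤ B l i)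
    (a b : ℝ) (ha : 0 < a)
    (ρ : Fin n → ℝ) (hρ : ∀ i, 0 ≤ ρ i ∧ ρ i ≤ 1)
    (t : ℝ)
    (ht : t = Finset.univ.sup' ⟨⟨0, hn⟩, Finset.mem_univ _⟩
        (fun l => ∑ i, B l i * ρ i + a * ρ l) - b) :
    IsLeast {c : ℝ | ∃ v : Fin m → ℝ, (∀ j, 0 ≤ v j) ∧
        (∀ l, -∑ j, α j * v j + ∑ i, B l i * ρ i + a * ρ l ≤ b) ∧
        c = ∑ j, v j}
      (max 0 t / αstar) := by
  subst ht
  have hle : ∀ j, α j ≤ αstar := fun j => hαs ▸ Finset.le_sup' α (Finset.mem_univ j)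
  constructor
  · obtain ⟨k, -, hk⟩ := Finset.exists_mem_eq_sup' ⟨⟨0, hm⟩, Finset.mem_univ _⟩ α
    rw [← hαs] at hk
    set M := Finset.univ.sup' ⟨⟨0, hn⟩, Finset.mem_univ _⟩
      (fun l => ∑ i, B l i * ρ i + a * ρ l) with hM
    refine ⟨Pi.single k (max 0 (M - b) / αstar), fun j => ?_, fun l => ?_, ?_⟩
    · exact (Pi.single_nonneg.2 (div_nonneg (le_max_left _ _) hαpos.le) :
        (0 : Fin m → ℝ) ≤ Pi.single k (max 0 (M - b) / αstar)) j
    · have hl : ∑ i, B l i * ρ i + a * ρ l ≤ M :=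
        Finset.le_sup' (fun l => ∑ i, B l i * ρ i + a * ρ l) (Finset.mem_univ l)
      have hsum : ∑ j, α j * (Pi.single k (max 0 (M - b) / αstar) : Fin m → ℝ) j
          = max 0 (M - b) := by
        simp only [Pi.single_apply, mul_ite, mul_zero, Finset.sum_ite_eq', Finset.mem_univ,
          if_true, ← hk]
        exact mul_div_cancel₀ _ hαpos.ne'
      rw [hsum]
      linarith [le_max_right 0 (M - b)]
    · simp
  · rintro c ⟨v, hv, hT, rfl⟩
    have hcool : ∑ j, α j * v j ≤ (∑ j, v j) * αstar := by
      rw [Finset.sum_mul]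
      refine Finset.sum_le_sum fun j _ => ?_
      rw [mul_comm]
      exact mul_le_mul_of_nonneg_left (hle j) (hv j)
    have hnonneg : 0 ≤ ∑ j, α j * v j :=
      Finset.sum_nonneg fun j _ => mul_nonneg (hα j) (hv j)
    rw [div_le_iff₀ hαpos]
    refine (max_le hnonneg ?_).trans hcool
    rw [sub_le_iff_le_add]
    exact Finset.sup'_le _ _ fun l _ => by linarith [hT l]
end

section
/- Fix reals a > 0 and b with b < 1 + a. For every C > 0 there exist positive integers p and D with p ≤ D and n = D·p, and a vector ρ̂ ∈ {0,1}^n with Σ_{i=1}^n ρ̂_i = D, such that max_{1 ≤ l ≤ n} (Σ_{i=1}^n B̂_{l,i} ρ̂_i + a ρ̂_l) − b > C · ( min_{ρ ∈ {0,1}^n, Σ_i ρ_i = D} max_{1 ≤ l ≤ n} (Σ_{i=1}^n B̂_{l,i} ρ_i + a ρ_l) − b ), where B̂ is the circulant n×n 0-1 matrix with B̂_{i,j} = 1 iff (j − i) mod n ∈ {0,…,p−1}. That is, on Case-2 instances the ratio (p + a − b)/(1 + a − b) between the cost of a valid simple-rounding output and the optimal integral cost can be made arbitrarily large (the optimal fractional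 solution is uniform, so every D-subset is a valid simple-rounding output). -/
/-- Exactly `D` of the first `D * p` natural numbers are multiples of `p`. -/
theorem sum_indicator_dvd (D p : ℕ) (hp : 0 < p) :
    ∑ i : Fin (D * p), (if p ∣ (i : ℕ) then (1 : ℝ) else 0) = D := by
  rw [← finProdFinEquiv.sum_comp, Fintype.sum_prod_type]
  have h : ∀ (x : Fin D) (y : Fin p),
      (if p ∣ ((finProdFinEquiv (x, y) : Fin (D * p)) : ℕ) then (1 : ℝ) else 0) =
        if y = ⟨0, hp⟩ then 1 else 0 := by
    intro x y
    refine if_congr ?_ rfl rfl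
    rw [finProdFinEquiv_apply_val, Nat.dvd_add_left (Dvd.intro _ rfl), Fin.ext_iff]
    exact ⟨fun h => Nat.eq_zero_of_dvd_of_lt h y.2, fun h => h ▸ dvd_zero p⟩
  simp_rw [h]
  simp

/-- Exactly `k` of the first `n` natural numbers are smaller than `k`, for `k ≤ n`. -/
theorem sum_indicator_lt (n k : ℕ) (hk : k ≤ n) :
    ∑ i : Fin n, (if (i : ℕ) < k then (1 : ℝ) else 0) = k := by
  rw [Finset.sum_boole, Fin.card_filter_val_lt, min_eq_right hk]

/-- A cyclic interval of length `p` in `ℤ / (D * p)` contains at most one multiple of `p`. -/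
theorem eq_of_dvd_of_mem_window {D p l i j : ℕ} (hl : l < D * p)
    (hi : i < D * p) (hj : j < D * p) (hpi : p ∣ i) (hpj : p ∣ j)
    (hwi : (i + D * p - l) % (D * p) < p) (hwj : (j + D * p - l) % (D * p) < p) : i = j := by
  have hsub : i + D * p - l ≡ j + D * p - l [MOD p] := by
    refine Nat.ModEq.add_right_cancel' l ?_
    rw [Nat.sub_add_cancel (by omega), Nat.sub_add_cancel (by omega)]
    exact ((Nat.modEq_zero_iff_dvd.2 hpi).trans (Nat.modEq_zero_iff_dvd.2 hpj).symm).add_right _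
  have hmod : i + D * p - l ≡ j + D * p - l [MOD D * p] := by
    have h : (i + D * p - l) % (D * p) % p = (j + D * p - l) % (D * p) % p := by
      rw [Nat.mod_mul_left_mod, Nat.mod_mul_left_mod]
      exact hsub
    rwa [Nat.mod_eq_of_lt hwi, Nat.mod_eq_of_lt hwj] at h
  have hadd := hmod.add_right l
  rw [Nat.sub_add_cancel (by omega), Nat.sub_add_cancel (by omega)] at hadd
  exact (Nat.ModEq.add_right_cancel' _ hadd).eq_of_lt_of_lt hi hj

/-- Every row of the circulant matrix sees at most one of the multiples of `p`. -/
theorem window_sum_dvd_le_one (D p : ℕ) (l : Fin (D * p)) :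
    ∑ i : Fin (D * p), (if ((i : ℕ) + D * p - (l : ℕ)) % (D * p) < p then (1 : ℝ) else 0) *
      (if p ∣ (i : ℕ) then 1 else 0) ≤ 1 := by
  simp_rw [ite_zero_mul_ite_zero, mul_one]
  rw [Finset.sum_boole]
  norm_cast
  refine Finset.card_le_one.2 fun i hi j hj => ?_
  simp only [Finset.mem_filter, Finset.mem_univ, true_and] at hi hj
  exact Fin.ext (eq_of_dvd_of_mem_window l.2 i.2 j.2 hi.2 hj.2 hi.1 hj.1)

/-- on Case-2 (circulant) instances the ratio between the cost
of a valid simple-rounding output and the optimal integral cost can be made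
arbitrarily large: for every C > 0 there are p ≤ D, n = D·p and a 0-1 vector
ρ̂ with Σρ̂ = D whose max row value minus b exceeds C times the optimal
min-max value minus b. -/
theorem stmt_11 (a b : ℝ) (ha : 0 < a) (hb : b < 1 + a) :
    ∀ C : ℝ, 0 < C →
    ∃ p D : ℕ, ∃ (hp : 0 < p) (hD : 0 < D), p ≤ D ∧
    ∃ ρhat : Fin (D * p) → ℝ,
      (∀ i, ρhat i = 0 ∨ ρhat i = 1) ∧ (∑ i, ρhat i = (D : ℝ)) ∧
      ∀ mstar : ℝ,
        IsLeast {t : ℝ | ∃ ρ : Fin (D * p) → ℝ,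
            (∀ i, ρ i = 0 ∨ ρ i = 1) ∧ (∑ i, ρ i = (D : ℝ)) ∧
            t = Finset.univ.sup' ⟨⟨0, Nat.mul_pos hD hp⟩, Finset.mem_univ _⟩
                  (fun l : Fin (D * p) =>
                    (∑ i : Fin (D * p),
                      (if ((i : ℕ) + D * p - (l : ℕ)) % (D * p) < p
                        then (1 : ℝ) else 0) * ρ i) + a * ρ l)} mstar →
        Finset.univ.sup' ⟨⟨0, Nat.mul_pos hD hp⟩, Finset.mem_univ _⟩
            (fun l : Fin (D * p) =>
              (∑ i : Fin (D * p),
                (if ((i : ℕ) + D * p - (l : ℕ)) % (D * p) < p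
                  then (1 : ℝ) else 0) * ρhat i) + a * ρhat l) - b
          > C * (mstar - b) := by
  intro C hC
  obtain ⟨m, hm⟩ := exists_nat_gt (C * (1 + a - b) - a + b)
  set p := m + 1 with hpdef
  have hp : 0 < p := m.succ_pos
  have hmp : (m : ℝ) < p := by rw [hpdef]; push_cast; linarith
  refine ⟨p, p, hp, hp, le_rfl, fun i => if (i : ℕ) < p then 1 else 0, fun i => ?_,
    sum_indicator_lt _ _ (Nat.le_mul_of_pos_left p hp), fun mstar hmstar => ?_⟩
  · dsimp only
    split_ifs <;> simp
  have hopt : mstar ≤ 1 + a := by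
    refine (hmstar.2 ⟨fun i => if p ∣ (i : ℕ) then 1 else 0, fun i => ?_,
      sum_indicator_dvd p p hp, rfl⟩).trans (Finset.sup'_le _ _ fun l _ => ?_)
    · dsimp only
      split_ifs <;> simp
    · refine add_le_add (window_sum_dvd_le_one p p l) ?_
      dsimp only
      split_ifs <;> linarith
  have hround : (p : ℝ) + a ≤ Finset.univ.sup' ⟨⟨0, Nat.mul_pos hp hp⟩, Finset.mem_univ _⟩
      (fun l : Fin (p * p) =>
        (∑ i : Fin (p * p),
          (if ((i : ℕ) + p * p - (l : ℕ)) % (p * p) < p then (1 : ℝ) else 0) *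
            (if (i : ℕ) < p then 1 else 0)) + a * (if (l : ℕ) < p then 1 else 0)) := by
    refine le_trans (le_of_eq ?_)
      (Finset.le_sup' _ (Finset.mem_univ (⟨0, Nat.mul_pos hp hp⟩ : Fin (p * p))))
    have hrow : ∀ i : Fin (p * p), ((i : ℕ) + p * p - 0) % (p * p) = i := fun i => by
      rw [Nat.sub_zero, Nat.add_mod_right, Nat.mod_eq_of_lt i.2]
    simp only [hrow, ite_zero_mul_ite_zero, and_self, if_pos hp, mul_one,
      sum_indicator_lt (p * p) p (Nat.le_mul_of_pos_left p hp)]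
  have hscale : C * (mstar - b) ≤ C * (1 + a - b) :=
    mul_le_mul_of_nonneg_left (by linarith) hC.le
  linarith
end

section
/- For every C > 0 there exist positive integers n and D with 3 < D and D + 3 ≤ n, a real v_L > 0 with 4·D/n ≤ 2 + v_L, and a Case-1 matrix B̂ with parameters n, D, p = 3 such that, for the Case 1 instance of the linearized data-center problem with m = 1, a = 1, b = 2, q = 1, B = B̂, and lower bound v_L on the single cooling variable: (i) the optimal value of the integral problem (p1) equals v_L (attained by ρ the indicator of {1,…,D} and v = v_L); and (ii) there exists ρ̂ ∈ {0,1}^n with Σ_{i=1}^n ρ̂_i = D such that every v ≥ v_L satisfying −v + Σ_{i=1}^n B̂_{l,i} ρ̂_i + ρ̂_l ≤ 2 for all l = 1,…,n satisfies v > C·v_L. Hence the approximation factor of simple rounding on Case 1 instances is unbounded. -/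
/-- the approximation factor of simple rounding on Case 1
instances is unbounded: for every C > 0 there is a Case 1 instance
(m = 1, a = 1, b = 2, q = 1, p = 3) whose integral optimum is v_L, attained
by the indicator of the first D servers with v = v_L, yet some valid 0-1
workload ρ̂ with Σρ̂ = D forces every feasible cooling value v ≥ v_L to
satisfy v > C·v_L. -/
theorem stmt_12 :
    ∀ C : ℝ, 0 < C →
    ∃ n D : ℕ, 3 < D ∧ D + 3 ≤ n ∧
    ∃ vL : ℝ, 0 < vL ∧ 4 * (D : ℝ) / n ≤ 2 + vL ∧
    ∃ B : Matrix (Fin n) (Fin n) ℝ,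
      (∀ i j, B i j = 0 ∨ B i j = 1) ∧
      (∀ i, ∑ j, B i j = (3 : ℝ)) ∧
      (∀ i : Fin n, (i : ℕ) < D → B i i = 1) ∧
      (∀ i j : Fin n, B i j = 1 → (i = j ∧ (i : ℕ) < D) ∨ D ≤ (j : ℕ)) ∧
      IsLeast {c : ℝ | ∃ (v : ℝ) (ρ : Fin n → ℝ),
          (∀ i, ρ i = 0 ∨ ρ i = 1) ∧ (∑ i, ρ i ≥ (D : ℝ)) ∧
          (∀ l, -v + ∑ i, B l i * ρ i + ρ l ≤ 2) ∧ vL ≤ v ∧ c = v} vL ∧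
      (∀ l : Fin n, -vL + ∑ i, B l i * (if (i : ℕ) < D then (1 : ℝ) else 0)
          + (if (l : ℕ) < D then (1 : ℝ) else 0) ≤ 2) ∧
      (∃ ρhat : Fin n → ℝ, (∀ i, ρhat i = 0 ∨ ρhat i = 1) ∧
        (∑ i, ρhat i = (D : ℝ)) ∧
        ∀ v : ℝ, vL ≤ v →
          (∀ l, -v + ∑ i, B l i * ρhat i + ρhat l ≤ 2) → v > C * vL) := by
  intro C hC
  have hvL : 0 < 1 / (C + 1) := by positivity
  have hCvL : C * (1 / (C + 1)) < 1 := by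
    rw [mul_one_div, div_lt_one (by linarith)]
    linarith
  have indicator_feasible : ∀ l : Fin 8, -(1 / (C + 1)) +
      ∑ i : Fin 8, (if i = 4 ∨ i = 5 ∨ i = (if (l : ℕ) < 4 then l else 6) then (1 : ℝ) else 0) *
        (if (i : ℕ) < 4 then (1 : ℝ) else 0) + (if (l : ℕ) < 4 then (1 : ℝ) else 0) ≤ 2 := by
    intro l
    generalize 1 / (C + 1) = w at hvL
    fin_cases l <;> simp [Fin.sum_univ_eight] <;> linarith
  refine ⟨8, 4, by norm_num, by norm_num, 1 / (C + 1), hvL, by norm_num; linarith,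
    Matrix.of fun i j => if j = 4 ∨ j = 5 ∨ j = (if (i : ℕ) < 4 then i else 6) then 1 else 0,
    ?_, ?_, ?_, ?_, ⟨?_, ?_⟩, ?_, ?_⟩
  · intro i j
    simp only [Matrix.of_apply]
    split_ifs <;> simp
  · intro i
    simp only [Matrix.of_apply, Finset.sum_boole]
    norm_cast
    revert i
    decide
  · intro i hi
    simp [hi]
  · intro i j h
    simp only [Matrix.of_apply, ite_eq_left_iff, zero_ne_one, imp_false, not_not] at h
    revert i j
    decide
  · refine ⟨_, fun i => if (i : ℕ) < 4 then 1 else 0, ?_, ?_, ?_, le_rfl, rfl⟩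
    · intro i
      dsimp only
      split_ifs <;> simp
    · simp only [Fin.sum_univ_eight]
      norm_num
    · exact indicator_feasible
  · rintro c ⟨v, ρ, -, -, -, hv, rfl⟩
    exact hv
  · exact indicator_feasible
  · refine ⟨fun i => if (i : ℕ) < 4 then 0 else 1, ?_, ?_, ?_⟩
    · intro i
      dsimp only
      split_ifs <;> simp
    · simp only [Fin.sum_univ_eight]
      norm_num
    · intro v _ h
      have h4 := h 4
      simp [Fin.sum_univ_eight] at h4
      linarith
end

section
/- Consider the LP relaxation of the linearized data-center problem (p1) in which: all n rows of the cooling matrix A are equal to a fixed nonnegative vector α ∈ ℝ^m with α* = max_{1 ≤ j ≤ m} α_j > 0; B is an n×n 0-1 matrix with exactly p ones in each row and exactly p ones in each column; E = 0; V_LB = 0; there are no upper bounds on v; a > 0; and 1 ≤ D ≤ n. Then the optimal value of the LP relaxation (minimizing Σ_{j=1}^m v_j over v ≥ 0 and ρ ∈ [0,1]^n with Σ_i ρ_i ≥ D and −Σ_j α_j v_j + Σ_i B_{l,i} ρ_i + a ρ_l ≤ b for all l) equals max(0, (p + a)·D/n − b)/α*, and an optimal solution distributes the load uniformly: ρ_i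 = D/n for all i. -/
/-- Summing `B l i * x i` over all entries of a matrix with constant column sums. -/
theorem sum_sum_mul_of_col_sum {ι κ R : Type*} [Fintype ι] [Fintype κ] [CommSemiring R]
    (B : Matrix ι κ R) (x : κ → R) {p : R} (hB : ∀ i, ∑ l, B l i = p) :
    ∑ l, ∑ i, B l i * x i = p * ∑ i, x i := by
  rw [Finset.sum_comm, Finset.mul_sum]
  exact Finset.sum_congr rfl fun i _ => by rw [← Finset.sum_mul, hB]

/-- LP relaxation with identical cooling rows α (max entry
α* > 0), doubly p-regular 0-1 recirculation matrix B, E = 0, V_LB = 0 and no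
upper bounds: the optimal value is max(0, (p+a)·D/n − b)/α*, and it is
attained with the uniform workload ρ_i = D/n. -/
theorem stmt_13
    (n m D p : ℕ) (hn : 0 < n) (hm : 0 < m) (hD1 : 1 ≤ D) (hDn : D ≤ n)
    (hp1 : 1 ≤ p) (hpn : p ≤ n)
    (α : Fin m → ℝ) (hα : ∀ j, 0 ≤ α j)
    (αstar : ℝ)
    (hαs : αstar = Finset.univ.sup' ⟨⟨0, hm⟩, Finset.mem_univ _⟩ α)
    (hαpos : 0 < αstar)
    (B : Matrix (Fin n) (Fin n) ℝ)
    (hB01 : ∀ l i, B l i = 0 ∨ B l i = 1)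
    (hBrow : ∀ l, ∑ i, B l i = (p : ℝ))
    (hBcol : ∀ i, ∑ l, B l i = (p : ℝ))
    (a b : ℝ) (ha : 0 < a) :
    IsLeast {c : ℝ | ∃ (v : Fin m → ℝ) (ρ : Fin n → ℝ),
        (∀ j, 0 ≤ v j) ∧ (∀ i, 0 ≤ ρ i ∧ ρ i ≤ 1) ∧ (∑ i, ρ i ≥ (D : ℝ)) ∧
        (∀ l, -∑ j, α j * v j + ∑ i, B l i * ρ i + a * ρ l ≤ b) ∧
        c = ∑ j, v j}
      (max 0 (((p : ℝ) + a) * D / n - b) / αstar) ∧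
    ∃ v : Fin m → ℝ, (∀ j, 0 ≤ v j) ∧
      (∀ l, -∑ j, α j * v j + ∑ i, B l i * ((D : ℝ) / n)
          + a * ((D : ℝ) / n) ≤ b) ∧
      ∑ j, v j = max 0 (((p : ℝ) + a) * D / n - b) / αstar := by
  have hn' : (0 : ℝ) < n := by exact_mod_cast hn
  obtain ⟨j₀, -, hj₀⟩ := Finset.exists_mem_eq_sup' ⟨⟨0, hm⟩, Finset.mem_univ _⟩ α
  rw [← hαs] at hj₀
  have hle : ∀ j, α j ≤ αstar := fun j => hαs ▸ Finset.le_sup' α (Finset.mem_univ j)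
  set K : ℝ := max 0 (((p : ℝ) + a) * D / n - b)
  have uniform : ∃ v : Fin m → ℝ, (∀ j, 0 ≤ v j) ∧
      (∀ l, -∑ j, α j * v j + ∑ i, B l i * ((D : ℝ) / n) + a * ((D : ℝ) / n) ≤ b) ∧
      ∑ j, v j = K / αstar := by
    refine ⟨Pi.single j₀ (K / αstar), fun j => ?_, fun l => ?_, by simp⟩
    · exact (Pi.single_nonneg.2 (div_nonneg (le_max_left _ _) hαpos.le) :
        (0 : Fin m → ℝ) ≤ Pi.single j₀ (K / αstar)) j
    · have hcool : ∑ j, α j * (Pi.single j₀ (K / αstar) : Fin m → ℝ) j = K := by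
        simp only [Pi.single_apply, mul_ite, mul_zero, Finset.sum_ite_eq', Finset.mem_univ,
          if_true, ← hj₀]
        field_simp
      have hKle : ((p : ℝ) + a) * D / n - b ≤ K := le_max_right _ _
      rw [hcool, ← Finset.sum_mul, hBrow]
      rw [mul_div_assoc, add_mul] at hKle
      linarith
  refine ⟨⟨?_, ?_⟩, uniform⟩
  · obtain ⟨v, hv, hcon, hsum⟩ := uniform
    refine ⟨v, fun _ => (D : ℝ) / n, hv, fun _ => ⟨by positivity, ?_⟩, ?_, hcon, hsum.symm⟩
    · exact (div_le_one hn').2 (by exact_mod_cast hDn)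
    · simp [mul_div_cancel₀ _ hn'.ne']
  · rintro c ⟨v, ρ, hv, -, hload, hcon, rfl⟩
    have hcool : ∑ j, α j * v j ≤ αstar * ∑ j, v j := by
      rw [Finset.mul_sum]
      exact Finset.sum_le_sum fun j _ => mul_le_mul_of_nonneg_right (hle j) (hv j)
    have htotal := Finset.sum_le_sum fun l (_ : l ∈ Finset.univ) => hcon l
    simp only [Finset.sum_add_distrib, sum_sum_mul_of_col_sum B ρ hBcol, ← Finset.mul_sum,
      Finset.sum_const, Finset.card_univ, Fintype.card_fin, nsmul_eq_mul] at htotal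
    have hdemand : ((p : ℝ) + a) * D ≤ (p + a) * ∑ i, ρ i :=
      mul_le_mul_of_nonneg_left hload (by positivity)
    rw [div_le_iff₀' hαpos]
    refine max_le (mul_nonneg hαpos.le (Finset.sum_nonneg fun j _ => hv j)) ?_
    rw [sub_le_iff_le_add, div_le_iff₀ hn']
    nlinarith [mul_le_mul_of_nonneg_left hcool hn'.le]
end
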